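/- arXiv:1204.4790 — 2 statements merged into one kernel-verified Lean document; each statement's English description precedes it below -/
import Mathlib

section
/- Let u be continuously differentiable on (a neighborhood of the closure of) the triangle 𝐓 and set ũ = u ∘ T. Then ∬_𝐓 |∇u|² dx dy = ∬_𝐐 (∂_ξ ũ + ∂_η ũ)² χ⁻¹ dξ dη + (1/16) ∬_𝐐 ( 2χ(∂_ξ ũ − ∂_η ũ) − (ξ−η)(∂_ξ ũ + ∂_η ũ) )² χ⁻¹ dξ dη, where χ = (2−ξ−η)/2. -/
noncomputable section

open Set MeasureTheory

/-- The reference square 𝐐 = (−1,1)². -/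
def Qsq : Set (ℝ × ℝ) := Ioo (-1 : ℝ) 1 ×ˢ Ioo (-1 : ℝ) 1

/-- The reference triangle 𝐓. -/
def Tri : Set (ℝ × ℝ) := {p | 0 < p.1 ∧ 0 < p.2 ∧ p.1 + p.2 < 1}

/-- The rectangle–triangle mapping T(ξ,η) = ((1+ξ)(3−η)/8, (3−ξ)(1+η)/8). -/
def Tmap : ℝ × ℝ → ℝ × ℝ :=
  fun q => ((1 + q.1) * (3 - q.2) / 8, (3 - q.1) * (1 + q.2) / 8)

def TJ (z : ℝ × ℝ) : ℝ × ℝ →L[ℝ] ℝ × ℝ :=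
  LinearMap.toContinuousLinearMap (Matrix.toLin (Module.Basis.finTwoProd ℝ) (Module.Basis.finTwoProd ℝ)
    !![(3 - z.2) / 8, -(1 + z.1) / 8; -(1 + z.2) / 8, (3 - z.1) / 8])

lemma TJ_det (z : ℝ × ℝ) : (TJ z).det = (2 - z.1 - z.2) / 16 := by
  simp only [TJ, LinearMap.det_toContinuousLinearMap, LinearMap.det_toLin, Matrix.det_fin_two_of]
  ring

lemma TJ_10 (z : ℝ × ℝ) : TJ z (1, 0) = ((3 - z.2) / 8, -(1 + z.2) / 8) := by
  rw [TJ, Matrix.toLin_finTwoProd_toContinuousLinearMap]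
  simp

lemma TJ_01 (z : ℝ × ℝ) : TJ z (0, 1) = (-(1 + z.1) / 8, (3 - z.1) / 8) := by
  rw [TJ, Matrix.toLin_finTwoProd_toContinuousLinearMap]
  simp

lemma Tmap_hasFDerivAt (z : ℝ × ℝ) : HasFDerivAt Tmap (TJ z) z := by
  unfold Tmap
  rw [TJ, Matrix.toLin_finTwoProd_toContinuousLinearMap]
  have h1 : HasFDerivAt (fun q : ℝ × ℝ => q.1) (ContinuousLinearMap.fst ℝ ℝ ℝ) z := hasFDerivAt_fst
  have h2 : HasFDerivAt (fun q : ℝ × ℝ => q.2) (ContinuousLinearMap.snd ℝ ℝ ℝ) z := hasFDerivAt_snd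
  have ha := ((h1.const_add 1).mul (h2.const_sub 3)).mul_const (1/8)
  have hb := ((h1.const_sub 3).mul (h2.const_add 1)).mul_const (1/8)
  have h := ha.prodMk hb
  convert! h using 1
  · ext q <;> simp <;> ring
  · ext <;> simp <;> ring

lemma Tmap_cont : Continuous Tmap := by
  unfold Tmap; fun_prop

lemma Tmap_inj : InjOn Tmap Qsq := by
  rintro ⟨a, b⟩ ⟨⟨h1, h2⟩, h3, h4⟩ ⟨c, d⟩ ⟨⟨h5, h6⟩, h7, h8⟩ h
  simp only [Tmap, Prod.mk.injEq] at h h1 h2 h3 h4 h5 h6 h7 h8 ⊢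
  obtain ⟨e1, e2⟩ := h
  have hd : a - b = c - d := by linarith
  have hs : ((a + b) - (c + d)) * ((2 - a - b) + (2 - c - d)) = 0 := by
    have hb : b = a - c + d := by linarith
    subst hb
    linarith
  have : a + b - (c + d) = 0 := by
    rcases mul_eq_zero.1 hs with h | h
    · exact h
    · linarith
  constructor <;> linarith

lemma Tmap_image : Tmap '' Qsq = Tri := by
  apply Subset.antisymm
  · rintro _ ⟨⟨a, b⟩, ⟨⟨h1, h2⟩, h3, h4⟩, rfl⟩
    simp only [Tmap, Tri, mem_ofPred_eq] at h1 h2 h3 h4 ⊢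
    refine ⟨?_, ?_, ?_⟩
    · have := mul_pos (show 0 < 1 + a by linarith) (show 0 < 3 - b by linarith)
      linarith
    · have := mul_pos (show 0 < 3 - a by linarith) (show 0 < 1 + b by linarith)
      linarith
    · have := mul_pos (show 0 < 1 - a by linarith) (show 0 < 1 - b by linarith)
      linarith
  · rintro ⟨x, y⟩ ⟨hx, hy, hxy⟩
    simp only at hx hy hxy
    have hp : 0 ≤ 16 * (1 - x - y) + 4 * (x - y) ^ 2 := by nlinarith [sq_nonneg (x - y)]
    obtain ⟨r, hr⟩ : ∃ r, r = √(16 * (1 - x - y) + 4 * (x - y) ^ 2) := ⟨_, rfl⟩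
    have hr0 : 0 ≤ r := hr ▸ Real.sqrt_nonneg _
    have hr2 : r ^ 2 = 16 * (1 - x - y) + 4 * (x - y) ^ 2 := by rw [hr, Real.sq_sqrt hp]
    have k1 : 2 * (x - y) < r := by
      apply lt_of_pow_lt_pow_left₀ 2 hr0; nlinarith
    have k2 : -(2 * (x - y)) < r := by
      apply lt_of_pow_lt_pow_left₀ 2 hr0; nlinarith
    have k3 : r < 4 + 2 * (x - y) := by
      apply lt_of_pow_lt_pow_left₀ 2 (by linarith); nlinarith
    have k4 : r < 4 - 2 * (x - y) := by
      apply lt_of_pow_lt_pow_left₀ 2 (by linarith); nlinarith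
    refine ⟨(1 - r / 2 + (x - y), 1 - r / 2 - (x - y)), ⟨⟨?_, ?_⟩, ?_, ?_⟩, ?_⟩
    · simp only; linarith
    · simp only; linarith
    · simp only; linarith
    · simp only; linarith
    · simp only [Tmap, Prod.mk.injEq]
      constructor <;> nlinarith

lemma Qsq_closure : closure Qsq = Icc (-1 : ℝ) 1 ×ˢ Icc (-1 : ℝ) 1 := by
  rw [Qsq, closure_prod_eq, closure_Ioo (by norm_num)]

lemma Qsq_meas : MeasurableSet Qsq := measurableSet_Ioo.prod measurableSet_Ioo

/-- Transformation of the Dirichlet energy: for u continuously differentiable on a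
neighborhood of the closure of 𝐓, writing ũ = u ∘ T and χ = (2−ξ−η)/2,
∬_𝐓 |∇u|² = ∬_𝐐 (∂_ξũ+∂_ηũ)² χ⁻¹
  + (1/16) ∬_𝐐 (2χ(∂_ξũ−∂_ηũ) − (ξ−η)(∂_ξũ+∂_ηũ))² χ⁻¹. -/
theorem dirichlet_energy_transform (u : ℝ × ℝ → ℝ) (U : Set (ℝ × ℝ))
    (hU : IsOpen U) (hTU : closure Tri ⊆ U) (hu : ContDiffOn ℝ 1 u U) :
    ∫ p in Tri, (fderiv ℝ u p (1, 0) ^ 2 + fderiv ℝ u p (0, 1) ^ 2) =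
      (∫ z in Qsq,
          (fderiv ℝ (u ∘ Tmap) z (1, 0) + fderiv ℝ (u ∘ Tmap) z (0, 1)) ^ 2 *
            ((2 - z.1 - z.2) / 2)⁻¹) +
        (1 / 16) *
          ∫ z in Qsq,
            (2 * ((2 - z.1 - z.2) / 2) *
                (fderiv ℝ (u ∘ Tmap) z (1, 0) - fderiv ℝ (u ∘ Tmap) z (0, 1)) -
              (z.1 - z.2) *
                (fderiv ℝ (u ∘ Tmap) z (1, 0) + fderiv ℝ (u ∘ Tmap) z (0, 1))) ^ 2 *
              ((2 - z.1 - z.2) / 2)⁻¹ := by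
  have hmaps : MapsTo Tmap (closure Qsq) U := by
    intro z hz
    apply hTU
    rw [← Tmap_image]
    exact image_closure_subset_closure_image Tmap_cont (mem_image_of_mem _ hz)
  have hcd : ContinuousOn (fun z => fderiv ℝ u (Tmap z)) (closure Qsq) :=
    (hu.continuousOn_fderiv_of_isOpen hU le_rfl).comp Tmap_cont.continuousOn hmaps
  have hca : ContinuousOn (fun z => fderiv ℝ u (Tmap z) (1, 0)) (closure Qsq) :=
    hcd.clm_apply continuousOn_const
  have hcb : ContinuousOn (fun z => fderiv ℝ u (Tmap z) (0, 1)) (closure Qsq) :=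
    hcd.clm_apply continuousOn_const
  have hcomp : IsCompact (closure Qsq) := by
    rw [Qsq_closure]; exact isCompact_Icc.prod isCompact_Icc
  have hchain : ∀ z ∈ Qsq, fderiv ℝ (u ∘ Tmap) z = (fderiv ℝ u (Tmap z)).comp (TJ z) := by
    intro z hz
    have hd : DifferentiableAt ℝ u (Tmap z) :=
      (hu.differentiableOn one_ne_zero).differentiableAt
        (hU.mem_nhds (hmaps (subset_closure hz)))
    exact (hd.hasFDerivAt.comp z (Tmap_hasFDerivAt z)).fderiv
  have hlin : ∀ (L : ℝ × ℝ →L[ℝ] ℝ) (p q : ℝ), L (p, q) = p * L (1, 0) + q * L (0, 1) := by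
    intro L p q
    have : ((p, q) : ℝ × ℝ) = p • ((1, 0) : ℝ × ℝ) + q • ((0, 1) : ℝ × ℝ) := by ext <;> simp
    rw [this, map_add, map_smul, map_smul, smul_eq_mul, smul_eq_mul]
  have hpos : ∀ z ∈ Qsq, 0 < 2 - z.1 - z.2 := by
    rintro z ⟨⟨_, h2⟩, _, h4⟩
    linarith
  have hξ : ∀ z ∈ Qsq, fderiv ℝ (u ∘ Tmap) z (1, 0) =
      (3 - z.2) / 8 * fderiv ℝ u (Tmap z) (1, 0) + -(1 + z.2) / 8 * fderiv ℝ u (Tmap z) (0, 1) := by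
    intro z hz
    rw [hchain z hz, ContinuousLinearMap.comp_apply, TJ_10, hlin]
  have hη : ∀ z ∈ Qsq, fderiv ℝ (u ∘ Tmap) z (0, 1) =
      -(1 + z.1) / 8 * fderiv ℝ u (Tmap z) (1, 0) + (3 - z.1) / 8 * fderiv ℝ u (Tmap z) (0, 1) := by
    intro z hz
    rw [hchain z hz, ContinuousLinearMap.comp_apply, TJ_01, hlin]
  have e1 := setIntegral_congr_fun (μ := volume) Qsq_meas (f := fun z : ℝ × ℝ =>
      (fderiv ℝ (u ∘ Tmap) z (1, 0) + fderiv ℝ (u ∘ Tmap) z (0, 1)) ^ 2 *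
            ((2 - z.1 - z.2) / 2)⁻¹)
      (g := fun z => (2 - z.1 - z.2) / 32 *
        (fderiv ℝ u (Tmap z) (1, 0) + fderiv ℝ u (Tmap z) (0, 1)) ^ 2) (by
    intro z hz
    have := (hpos z hz).ne'
    simp only [hξ z hz, hη z hz]
    field_simp
    ring)
  have e2 := setIntegral_congr_fun (μ := volume) Qsq_meas (f := fun z : ℝ × ℝ =>
      (2 * ((2 - z.1 - z.2) / 2) *
                (fderiv ℝ (u ∘ Tmap) z (1, 0) - fderiv ℝ (u ∘ Tmap) z (0, 1)) -
              (z.1 - z.2) *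
                (fderiv ℝ (u ∘ Tmap) z (1, 0) + fderiv ℝ (u ∘ Tmap) z (0, 1))) ^ 2 *
              ((2 - z.1 - z.2) / 2)⁻¹)
      (g := fun z => (2 - z.1 - z.2) / 2 *
        (fderiv ℝ u (Tmap z) (1, 0) - fderiv ℝ u (Tmap z) (0, 1)) ^ 2) (by
    intro z hz
    have := (hpos z hz).ne'
    simp only [hξ z hz, hη z hz]
    field_simp
    ring)
  have i1 : IntegrableOn (fun z : ℝ × ℝ => (2 - z.1 - z.2) / 32 *
        (fderiv ℝ u (Tmap z) (1, 0) + fderiv ℝ u (Tmap z) (0, 1)) ^ 2) Qsq := by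
    refine (ContinuousOn.integrableOn_compact hcomp ?_).mono_set subset_closure
    exact (Continuous.continuousOn (by fun_prop)).mul ((hca.add hcb).pow 2)
  have i2 : IntegrableOn (fun z : ℝ × ℝ => (2 - z.1 - z.2) / 2 *
        (fderiv ℝ u (Tmap z) (1, 0) - fderiv ℝ u (Tmap z) (0, 1)) ^ 2) Qsq := by
    refine (ContinuousOn.integrableOn_compact hcomp ?_).mono_set subset_closure
    exact (Continuous.continuousOn (by fun_prop)).mul ((hca.sub hcb).pow 2)
  rw [e1, e2, ← integral_const_mul, ← integral_add i1 (i2.const_mul _), ← Tmap_image,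
    integral_image_eq_integral_abs_det_fderiv_smul volume Qsq_meas
      (fun z _ => (Tmap_hasFDerivAt z).hasFDerivWithinAt) Tmap_inj]
  refine setIntegral_congr_fun Qsq_meas ?_
  intro z hz
  have := hpos z hz
  simp only [TJ_det, smul_eq_mul]
  rw [abs_of_pos (by linarith)]
  ring
end
end

section
/- For every integer p ≥ 1, the quantities â_{pq} = ∬_𝐐 L_p(ξ) L_q(η)/(2 − ξ − η) dξ dη satisfy â_{p1} = 2 â_{p0} − ((p+1) â_{p+1,0} + p â_{p−1,0})/(2p+1). -/
noncomputable section

open Set MeasureTheory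

/-- The Legendre polynomial of degree k, given by the Rodrigues formula
L_k(x) = 1/(2^k k!) d^k/dx^k (x²−1)^k. -/
def legendre (k : ℕ) : Polynomial ℝ :=
  Polynomial.C (1 / (2 ^ k * (Nat.factorial k : ℝ))) *
    (Polynomial.derivative^[k] ((Polynomial.X ^ 2 - 1) ^ k))

/-- â_{pq} = ∬_𝐐 L_p(ξ) L_q(η)/(2 − ξ − η) dξ dη. -/
def ahat (p q : ℕ) : ℝ :=
  ∫ z in Qsq, (legendre p).eval z.1 * (legendre q).eval z.2 / (2 - z.1 - z.2)

open Polynomial in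
theorem aux_bonnet (n : ℕ) :
    (derivative^[n+2] ((X ^ 2 - 1 : ℝ[X]) ^ (n+2))) =
      C (2 * (2 * ((n:ℝ)+1) + 1)) * (X * derivative^[n+1] ((X ^ 2 - 1 : ℝ[X]) ^ (n+1)))
      - C (4 * ((n:ℝ)+1)^2) * derivative^[n] ((X ^ 2 - 1 : ℝ[X]) ^ n) := by
  have h1 : derivative ((X ^ 2 - 1 : ℝ[X]) ^ (n+2)) =
      C (2 * ((n:ℝ)+2)) * (X * (X ^ 2 - 1 : ℝ[X]) ^ (n+1)) := by
    simp only [derivative_pow, derivative_sub, derivative_one, derivative_X_pow, map_mul, map_add,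
      map_natCast, map_ofNat, derivative_X]
    push_cast
    simp
    ring
  have h2 : derivative (derivative ((X ^ 2 - 1 : ℝ[X]) ^ (n+2))) =
      C (2 * ((n:ℝ)+2) * (2*n+3)) * (X ^ 2 - 1 : ℝ[X]) ^ (n+1) +
      C (4 * ((n:ℝ)+1)*(n+2)) * (X ^ 2 - 1 : ℝ[X]) ^ n := by
    rw [h1]
    simp only [derivative_mul, derivative_C, derivative_pow, derivative_sub, derivative_one,
      derivative_X_pow, map_mul, map_add,
      map_natCast, map_ofNat, derivative_X]
    push_cast
    simp
    ring
  have hA : (derivative^[n+2] ((X ^ 2 - 1 : ℝ[X]) ^ (n+2))) =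
      C (2 * ((n:ℝ)+2)) * (X * derivative^[n+1] ((X ^ 2 - 1 : ℝ[X]) ^ (n+1)) +
        C ((n:ℝ)+1) * derivative^[n] ((X ^ 2 - 1 : ℝ[X]) ^ (n+1))) := by
    rw [Function.iterate_succ_apply, h1, iterate_derivative_C_mul, mul_comm X,
      iterate_derivative_mul_X]
    simp only [map_mul, map_add, map_natCast, map_ofNat, map_one, nsmul_eq_mul, Nat.cast_add, Nat.cast_one, Nat.add_sub_cancel]
    ring
  have hB : (derivative^[n+2] ((X ^ 2 - 1 : ℝ[X]) ^ (n+2))) =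
      C (2 * ((n:ℝ)+2) * (2*n+3)) * derivative^[n] ((X ^ 2 - 1 : ℝ[X]) ^ (n+1)) +
      C (4 * ((n:ℝ)+1)*(n+2)) * derivative^[n] ((X ^ 2 - 1 : ℝ[X]) ^ n) := by
    rw [Function.iterate_succ_apply, Function.iterate_succ_apply, h2, iterate_map_add,
      iterate_derivative_C_mul, iterate_derivative_C_mul]
  generalize derivative^[n+2] ((X ^ 2 - 1 : ℝ[X]) ^ (n+2)) = R2 at *
  generalize derivative^[n+1] ((X ^ 2 - 1 : ℝ[X]) ^ (n+1)) = R1 at *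
  generalize derivative^[n] ((X ^ 2 - 1 : ℝ[X]) ^ (n+1)) = S at *
  generalize derivative^[n] ((X ^ 2 - 1 : ℝ[X]) ^ n) = R0 at *
  have hne : (C ((n:ℝ)+2) : ℝ[X]) ≠ 0 := by
    rw [Ne, C_eq_zero]; positivity
  apply mul_left_cancel₀ hne
  have e : C ((n:ℝ)+2) * R2 = C (2*(n:ℝ)+3) * R2 - C ((n:ℝ)+1) * R2 := by
    rw [← sub_mul, ← C_sub]; congr 2; ring
  rw [e]
  nth_rewrite 1 [hA]
  rw [hB]
  simp only [map_mul, map_add, map_natCast, map_ofNat, map_pow, map_one]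
  ring

theorem legendre_rec (n : ℕ) (x : ℝ) :
    x * (legendre (n+1)).eval x =
      (((n:ℝ)+2) * (legendre (n+2)).eval x + ((n:ℝ)+1) * (legendre n).eval x) /
        (2 * ((n:ℝ)+1) + 1) := by
  have h := congrArg (Polynomial.eval x) (aux_bonnet n)
  simp only [legendre, Polynomial.eval_mul, Polynomial.eval_C, Polynomial.eval_sub,
    Polynomial.eval_X] at h ⊢
  rw [h]
  have hf : (n.factorial : ℝ) ≠ 0 := by positivity
  have h3 : 2 * ((n:ℝ)+1) + 1 ≠ 0 := by positivity
  have h2 : (n:ℝ) + 1 + 1 ≠ 0 := by positivity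
  have h1 : (n:ℝ) + 1 ≠ 0 := by positivity
  simp only [Nat.factorial_succ, Nat.cast_mul, Nat.cast_add, Nat.cast_one, pow_succ]
  push_cast
  rw [show (n:ℝ) + 2 = n + 1 + 1 by ring]
  field_simp
  ring

theorem legendre_int (n : ℕ) : ∫ x in Ioo (-1:ℝ) 1, (legendre (n+1)).eval x = 0 := by
  rw [← integral_Ioc_eq_integral_Ioo, ← intervalIntegral.integral_of_le (by norm_num)]
  set S : Polynomial ℝ := Polynomial.C (1 / (2 ^ (n+1) * (Nat.factorial (n+1) : ℝ))) *
    (Polynomial.derivative^[n] ((Polynomial.X ^ 2 - 1) ^ (n+1))) with hS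
  have hd : Polynomial.derivative S = legendre (n+1) := by
    rw [hS, Polynomial.derivative_C_mul, ← Function.iterate_succ_apply' Polynomial.derivative]; rfl
  have hdv : (Polynomial.X ^ 2 - 1 : Polynomial ℝ) ∣ S := by
    apply Dvd.dvd.mul_left
    have := Polynomial.pow_sub_dvd_iterate_derivative_pow (Polynomial.X ^ 2 - 1 : Polynomial ℝ) (n+1) n
    simpa using this
  obtain ⟨T, hT⟩ := hdv
  rw [intervalIntegral.integral_eq_sub_of_hasDerivAt (f := fun x => S.eval x)]
  · rw [hT]; simp
  · intro x _
    rw [← hd]; exact S.hasDerivAt x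
  · exact (Polynomial.continuous _).intervalIntegrable _ _

theorem vol_Qsq : (volume : Measure (ℝ × ℝ)).restrict Qsq =
    (volume.restrict (Ioo (-1:ℝ) 1)).prod (volume.restrict (Ioo (-1:ℝ) 1)) := by
  rw [Measure.prod_restrict]; rfl

theorem oneD (P : Polynomial ℝ) :
    Integrable (fun x : ℝ => P.eval x * (1 - x) ^ (-(1/2) : ℝ)) (volume.restrict (Ioo (-1:ℝ) 1)) := by
  have h : IntervalIntegrable (fun x : ℝ => x ^ (-(1/2) : ℝ)) volume 2 0 :=
    intervalIntegral.intervalIntegrable_rpow' (by norm_num)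
  have h2 := h.comp_sub_left 1
  norm_num at h2
  have h3 : IntervalIntegrable (fun x : ℝ => P.eval x * (1 - x) ^ (-(1/2) : ℝ)) volume (-1) 1 :=
    h2.continuousOn_mul P.continuous.continuousOn
  rw [intervalIntegrable_iff_integrableOn_Ioo_of_le (by norm_num)] at h3
  exact h3

theorem twoD (P : Polynomial ℝ) :
    IntegrableOn (fun z : ℝ × ℝ => P.eval z.1 / (2 - z.1 - z.2)) Qsq := by
  have h := (oneD P).norm.mul_prod (oneD 1)
  rw [← vol_Qsq] at h
  have hQ : MeasurableSet Qsq := measurableSet_Ioo.prod measurableSet_Ioo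
  refine Integrable.mono' h ?_ ?_
  · apply Measurable.aestronglyMeasurable
    have := P.continuous.measurable
    fun_prop
  · refine (ae_restrict_iff' hQ).2 (Filter.Eventually.of_forall ?_)
    rintro ⟨x, y⟩ ⟨⟨hx1, hx2⟩, ⟨hy1, hy2⟩⟩
    simp only at hx1 hx2 hy1 hy2 ⊢
    have ha : 0 < 1 - x := by linarith
    have hb : 0 < 1 - y := by linarith
    simp only [Polynomial.eval_one, one_mul, norm_mul, norm_div]
    rw [Real.rpow_neg ha.le, Real.rpow_neg hb.le, ← Real.sqrt_eq_rpow, ← Real.sqrt_eq_rpow,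
      mul_assoc, div_eq_mul_inv]
    apply mul_le_mul_of_nonneg_left _ (norm_nonneg _)
    have sa := Real.sqrt_pos.2 ha
    have sb := Real.sqrt_pos.2 hb
    rw [Real.norm_of_nonneg (inv_nonneg.2 sa.le), Real.norm_of_nonneg (by linarith), ← mul_inv]
    apply inv_anti₀ (by positivity)
    nlinarith [Real.sq_sqrt ha.le, Real.sq_sqrt hb.le, sq_nonneg (√(1-x) - √(1-y)), mul_pos sa sb]

theorem ahat_p1 (p : ℕ) (hp : 1 ≤ p) :
    ahat p 1 =
      2 * ahat p 0 -
        (((p : ℝ) + 1) * ahat (p + 1) 0 + (p : ℝ) * ahat (p - 1) 0) /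
          (2 * (p : ℝ) + 1) := by
  obtain ⟨n, rfl⟩ : ∃ n, p = n + 1 := ⟨p - 1, by omega⟩
  have hQ : MeasurableSet Qsq := measurableSet_Ioo.prod measurableSet_Ioo
  have l0 : legendre 0 = 1 := by simp [legendre]
  have l1 : legendre 1 = Polynomial.X := by
    have : (Polynomial.C (2:ℝ)⁻¹ * (Polynomial.C 2 * Polynomial.X) : Polynomial ℝ) = Polynomial.X := by
      rw [← mul_assoc, ← Polynomial.C_mul]; norm_num
    simpa [legendre, one_add_one_eq_two] using this
  have a0 : ∀ m, ahat m 0 = ∫ z in Qsq, (legendre m).eval z.1 / (2 - z.1 - z.2) := by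
    intro m; simp [ahat, l0]
  have hz : ∫ z in Qsq, (legendre (n+1)).eval z.1 = 0 := by
    have := integral_prod_mul (μ := volume.restrict (Ioo (-1:ℝ) 1))
      (ν := volume.restrict (Ioo (-1:ℝ) 1)) (fun x => (legendre (n+1)).eval x) (fun _ => (1:ℝ))
    rw [legendre_int, zero_mul, ← vol_Qsq] at this
    simpa using this
  have hzi : IntegrableOn (fun z : ℝ × ℝ => (legendre (n+1)).eval z.1) Qsq := by
    apply IntegrableOn.mono_set (t := Icc (-1) 1 ×ˢ Icc (-1) 1)
    · apply ContinuousOn.integrableOn_compact (isCompact_Icc.prod isCompact_Icc)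
      exact ((legendre (n+1)).continuous.comp continuous_fst).continuousOn
    · exact Set.prod_mono Ioo_subset_Icc_self Ioo_subset_Icc_self
  have i1 := twoD (legendre (n+1))
  have i2 := twoD (legendre (n+2))
  have i0 := twoD (legendre n)
  have key : ahat (n+1) 1 = ∫ z in Qsq, ((2 * ((legendre (n+1)).eval z.1 / (2 - z.1 - z.2)) -
      (((n:ℝ)+2) * ((legendre (n+2)).eval z.1 / (2 - z.1 - z.2)) +
        ((n:ℝ)+1) * ((legendre n).eval z.1 / (2 - z.1 - z.2))) / (2 * ((n:ℝ)+1) + 1))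
      - (legendre (n+1)).eval z.1) := by
    refine setIntegral_congr_fun hQ ?_
    rintro ⟨x, y⟩ ⟨⟨hx1, hx2⟩, ⟨hy1, hy2⟩⟩
    simp only at hx1 hx2 hy1 hy2 ⊢
    have hr := legendre_rec n x
    have hd : 2 - x - y ≠ 0 := by linarith
    have h3 : 2 * ((n:ℝ)+1) + 1 ≠ 0 := by positivity
    rw [l1, Polynomial.eval_X]
    have e : (((n:ℝ)+2) * ((legendre (n+2)).eval x / (2 - x - y)) +
        ((n:ℝ)+1) * ((legendre n).eval x / (2 - x - y))) / (2 * ((n:ℝ)+1) + 1) =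
        x * (legendre (n+1)).eval x / (2 - x - y) := by
      rw [hr]; field_simp
    rw [e]
    field_simp
    ring
  rw [key, integral_sub _ hzi, hz, sub_zero, integral_sub, integral_const_mul, integral_div,
    integral_add, integral_const_mul, integral_const_mul, a0, a0, a0]
  · push_cast
    simp only [show n + 1 - 1 = n from rfl, show n + 1 + 1 = n + 2 from rfl]
    ring
  · exact i2.const_mul _
  · exact i0.const_mul _
  · exact i1.const_mul _
  · exact ((i2.const_mul _).add (i0.const_mul _)).div_const _
  · exact (i1.const_mul _).sub (((i2.const_mul _).add (i0.const_mul _)).div_const _)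
end
end
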